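/- Let m ≥ 1 be an integer. Let E be a finite type, a : E → Fin 6 with every fiber of a having exactly 2m+1 elements, and b : E → Fin (6m+3) with every fiber of b having exactly 2 elements. For S ⊆ Fin 6, let N(S) = {y | ∃ e, a e ∈ S ∧ b e = y}. Call distinct vertices x, y : Fin 6 complementary if |N({x, y})| = 2m+1. Let u, v, f : Fin 6 be pairwise distinct with u and v not complementary. Then there exists w : Fin 6 with w ∉ {u, v, f}, such that |N({u, v, w})| ≥ 3m+3 and no two of the vertices u, v, w are complementary. -/

import Mathlib

/-- The union of the neighborhoods of the vertices of `S` in the bipartite multigraph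
with edge set `E` and endpoint maps `a`, `b`. -/
def nbrSet {E L R : Type} (a : E → L) (b : E → R) (S : Set L) : Set R :=
  {y | ∃ e, a e ∈ S ∧ b e = y}

/-- The number of edges joining `x` to `y`. -/
noncomputable def edgeMult {E L R : Type} [Fintype E] (a : E → L) (b : E → R) (x : L) (y : R) : ℕ :=
  Nat.card {e : E | a e = x ∧ b e = y}

/-- The number of paths of length two from `x` to `z`, counted with multiplicity. -/
noncomputable def codegree {E L R : Type} [Fintype E] [Fintype R] (a : E → L) (b : E → R)
    (x z : L) : ℕ :=
  ∑ y, edgeMult a b x y * edgeMult a b z y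

section

variable {E L R : Type} [Fintype E] (a : E → L) (b : E → R)

theorem codegree_comm [Fintype R] (x z : L) : codegree a b x z = codegree a b z x := by
  simp only [codegree, mul_comm]

theorem sum_edgeMult_left [Fintype L] (y : R) :
    ∑ x, edgeMult a b x y = Nat.card {e : E | b e = y} := by
  classical
  simp only [edgeMult, Nat.card_eq_fintype_card, Set.coe_ofPred, Fintype.card_subtype]
  rw [Finset.card_eq_sum_card_fiberwise (f := a) (t := Finset.univ) (by simp)]
  simp only [Finset.filter_filter, and_comm]

theorem sum_edgeMult_right [Fintype R] (x : L) :
    ∑ y, edgeMult a b x y = Nat.card {e : E | a e = x} := by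
  classical
  simp only [edgeMult, Nat.card_eq_fintype_card, Set.coe_ofPred, Fintype.card_subtype]
  rw [Finset.card_eq_sum_card_fiberwise (f := b) (t := Finset.univ) (by simp)]
  simp only [Finset.filter_filter]

theorem exists_codegree_self_eq [Fintype R] (x : L) :
    ∃ l, codegree a b x x = Nat.card {e : E | a e = x} + 2 * l := by
  refine ⟨∑ y, (edgeMult a b x y).choose 2, ?_⟩
  rw [codegree, ← sum_edgeMult_right a b x, Finset.mul_sum, ← Finset.sum_add_distrib]
  refine Finset.sum_congr rfl fun y _ => ?_
  generalize edgeMult a b x y = s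
  rw [Nat.choose_two_right, Nat.mul_div_cancel' (Nat.even_mul_pred_self s).two_dvd]
  cases s with
  | zero => simp
  | succ n =>
    simp only [add_tsub_cancel_right]
    ring

theorem mem_nbrSet_iff_sum_edgeMult (S : Finset L) (y : R) :
    y ∈ nbrSet a b (S : Set L) ↔ ∑ x ∈ S, edgeMult a b x y ≠ 0 := by
  rw [Ne, Finset.sum_eq_zero_iff]
  push Not
  constructor
  · rintro ⟨e, he, rfl⟩
    refine ⟨a e, he, ?_⟩
    have : Nonempty {e' : E | a e' = a e ∧ b e' = b e} := ⟨⟨e, rfl, rfl⟩⟩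
    exact Nat.card_pos.ne'
  · rintro ⟨x, hx, hne⟩
    obtain ⟨e, rfl, he⟩ := (Nat.card_ne_zero.mp hne).1
    exact ⟨e, hx, he⟩

variable {a b} [Fintype L] [Fintype R]

theorem two_mul_ncard_nbrSet_add (hb : ∀ y : R, Nat.card {e : E | b e = y} = 2) (S : Finset L) :
    2 * (nbrSet a b (S : Set L)).ncard + ∑ x ∈ S, ∑ z ∈ S, codegree a b x z
      = 3 * ∑ x ∈ S, Nat.card {e : E | a e = x} := by
  classical
  have h1 : (nbrSet a b (S : Set L)).ncard
      = ∑ y, if ∑ x ∈ S, edgeMult a b x y ≠ 0 then 1 else 0 := by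
    rw [← Finset.card_filter, ← Set.ncard_coe_finset]
    congr 1
    ext y
    simp only [mem_nbrSet_iff_sum_edgeMult, Finset.coe_filter, Finset.mem_univ, true_and,
      Set.mem_ofPred_eq]
  have h2 : ∑ x ∈ S, ∑ z ∈ S, codegree a b x z
      = ∑ y, (∑ x ∈ S, edgeMult a b x y) * ∑ x ∈ S, edgeMult a b x y := by
    simp only [codegree, Finset.sum_mul_sum]
    rw [Finset.sum_comm (s := Finset.univ)]
    refine Finset.sum_congr rfl fun x _ => ?_
    rw [Finset.sum_comm]
  have h3 : ∑ x ∈ S, Nat.card {e : E | a e = x} = ∑ y, ∑ x ∈ S, edgeMult a b x y := by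
    rw [Finset.sum_comm]
    exact Finset.sum_congr rfl fun x _ => (sum_edgeMult_right a b x).symm
  rw [h1, h2, h3, Finset.mul_sum, Finset.mul_sum, ← Finset.sum_add_distrib]
  refine Finset.sum_congr rfl fun y _ => ?_
  have hle : ∑ x ∈ S, edgeMult a b x y ≤ 2 := by
    rw [← hb y, ← sum_edgeMult_left a b y]
    exact Finset.sum_le_sum_of_subset (Finset.subset_univ S)
  generalize ∑ x ∈ S, edgeMult a b x y = s at hle ⊢
  interval_cases s <;> rfl

theorem sum_codegree (hb : ∀ y : R, Nat.card {e : E | b e = y} = 2) (x : L) :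
    ∑ z, codegree a b x z = 2 * Nat.card {e : E | a e = x} := by
  simp only [codegree]
  rw [Finset.sum_comm, ← sum_edgeMult_right a b x, Finset.mul_sum]
  refine Finset.sum_congr rfl fun y _ => ?_
  rw [← Finset.mul_sum, sum_edgeMult_left, hb, mul_comm]

end

/-- The counting core of `stmt12`: `c` is the codegree, `P x z` is the size of the neighborhood of
`{x, z}` and `T w` that of `{u, v, w}`. -/
theorem exists_of_codegree_relations {V : Type} {m : ℕ} {c P : V → V → ℕ} {T : V → ℕ}
    {u v f p q r : V} (hsymm : ∀ x z, c x z = c z x)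
    (hp : p ≠ u ∧ p ≠ v ∧ p ≠ f) (hq : q ≠ u ∧ q ≠ v ∧ q ≠ f) (hr : r ≠ u ∧ r ≠ v ∧ r ≠ f)
    (huv : u ≠ v) (hnotcomp : P u v ≠ 2 * m + 1)
    (hrow : ∀ x, c x p + c x q + c x r + c x u + c x v + c x f = 4 * m + 2)
    (hdiag : ∀ x, ∃ l, c x x = 2 * m + 1 + 2 * l)
    (hpair : ∀ x z, x ≠ z → 2 * P x z + (c x x + c z z + 2 * c x z) = 12 * m + 6)
    (htriple : ∀ w, w ≠ u → w ≠ v →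
      2 * T w + (c u u + c v v + c w w + 2 * c u v + 2 * c u w + 2 * c v w) = 18 * m + 9) :
    ∃ w, w ≠ u ∧ w ≠ v ∧ w ≠ f ∧ 3 * m + 3 ≤ T w ∧ P u w ≠ 2 * m + 1 ∧ P v w ≠ 2 * m + 1 := by
  by_contra hno
  push Not at hno
  have huv_cut : 2 ≤ c u p + c u q + c u r + c u f
      + c v p + c v q + c v r + c v f := by
    have h1 := hpair u v huv
    have h2 := hrow u
    have h3 := hrow v
    rw [hsymm v u] at h3
    omega
  have fail (w x y : V) (hw : w ≠ u ∧ w ≠ v ∧ w ≠ f)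
      (hrow' : ∀ s, c s u + c s v + c s f + c s w
        + c s x + c s y = 4 * m + 2) :
      (c u x + c u y + c u f + c v x
        + c v y + c v f + c w x + c w y
        + c w f ≤ 1) ∨
      (1 ≤ c u w ∧ c u x + c u y + c u f = 0) ∨
      (1 ≤ c v w ∧ c v x + c v y + c v f = 0) := by
    have hu := hrow' u
    have hv := hrow' v
    have hw' := hrow' w
    rw [hsymm v u] at hv
    rw [hsymm w u, hsymm w v] at hw'
    by_cases h1 : 3 * m + 3 ≤ T w
    · by_cases h2 : P u w = 2 * m + 1
      · obtain ⟨l, hl⟩ := hdiag u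
        have := hpair u w hw.1.symm
        right; left
        omega
      · have h3 := hno w hw.1 hw.2.1 hw.2.2 h1 h2
        obtain ⟨l, hl⟩ := hdiag v
        have := hpair v w hw.2.1.symm
        right; right
        omega
    · have := htriple w hw.1 hw.2.1
      left
      omega
  have hqp := hsymm q p
  have hrp := hsymm r p
  have hrq := hsymm r q
  have hfp := fail p q r hp fun s => by rw [← hrow s]; ring
  have hfq := fail q p r hq fun s => by rw [← hrow s]; ring
  have hfr := fail r p q hr fun s => by rw [← hrow s]; ring
  clear fail hpair htriple hrow hdiag hno
  omega

/-- Lemma 8: in a bipartite multigraph with left part `Fin 6`, right part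
`Fin (6m+3)`, left multidegrees `2m+1` and right multidegrees `2`, from three distinct
left vertices `u`, `v`, `f` with `u`, `v` not complementary, one can always find a left
vertex `w ∉ {u, v, f}` with `|N({u,v,w})| ≥ 3m+3` such that no two of `u`, `v`, `w` are
complementary (vertices `x ≠ y` being complementary when `|N({x,y})| = 2m+1`). -/
theorem stmt12 (m : ℕ) (hm : 1 ≤ m) (E : Type) [Fintype E]
    (a : E → Fin 6) (b : E → Fin (6 * m + 3))
    (ha : ∀ x : Fin 6, Nat.card {e : E | a e = x} = 2 * m + 1)
    (hb : ∀ y : Fin (6 * m + 3), Nat.card {e : E | b e = y} = 2)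
    (u v f : Fin 6) (huv : u ≠ v) (huf : u ≠ f) (hvf : v ≠ f)
    (hnotcomp : (nbrSet a b {u, v}).ncard ≠ 2 * m + 1) :
    ∃ w : Fin 6, w ≠ u ∧ w ≠ v ∧ w ≠ f ∧
      3 * m + 3 ≤ (nbrSet a b {u, v, w}).ncard ∧
      (nbrSet a b {u, w}).ncard ≠ 2 * m + 1 ∧
      (nbrSet a b {v, w}).ncard ≠ 2 * m + 1 := by
  classical
  have hcard : (Finset.univ \ {u, v, f} : Finset (Fin 6)).card = 3 := by
    rw [Finset.card_sdiff_of_subset (Finset.subset_univ _), Finset.card_eq_three.mpr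
      ⟨u, v, f, huv, huf, hvf, rfl⟩]
    rfl
  obtain ⟨p, q, r, hpq, hpr, hqr, hS⟩ := Finset.card_eq_three.mp hcard
  have hmem : ∀ w, w ∈ ({p, q, r} : Finset (Fin 6)) → w ≠ u ∧ w ≠ v ∧ w ≠ f := by
    intro w hw
    rw [← hS] at hw
    simpa using hw
  have hp := hmem p (by simp)
  have hq := hmem q (by simp)
  have hr := hmem r (by simp)
  have hrow (x : Fin 6) : codegree a b x p + codegree a b x q + codegree a b x r
      + codegree a b x u + codegree a b x v + codegree a b x f = 4 * m + 2 := by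
    have h := sum_codegree (a := a) hb x
    rw [ha, ← Finset.sum_sdiff (Finset.subset_univ {u, v, f}), hS,
      Finset.sum_insert (by simp [hpq, hpr]), Finset.sum_pair hqr,
      Finset.sum_insert (by simp [huv, huf]), Finset.sum_pair hvf] at h
    omega
  have hdiag (x : Fin 6) : ∃ l, codegree a b x x = 2 * m + 1 + 2 * l := by
    simpa only [ha] using exists_codegree_self_eq (a := a) (b := b) x
  have hpair (x z : Fin 6) (h : x ≠ z) : 2 * (nbrSet a b {x, z}).ncard
      + (codegree a b x x + codegree a b z z + 2 * codegree a b x z) = 12 * m + 6 := by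
    have h' := two_mul_ncard_nbrSet_add (a := a) hb {x, z}
    simp only [Finset.sum_pair h, ha, codegree_comm a b z x, Finset.coe_pair] at h'
    omega
  have htriple (w : Fin 6) (hwu : w ≠ u) (hwv : w ≠ v) : 2 * (nbrSet a b {u, v, w}).ncard
      + (codegree a b u u + codegree a b v v + codegree a b w w + 2 * codegree a b u v
        + 2 * codegree a b u w + 2 * codegree a b v w) = 18 * m + 9 := by
    have h' := two_mul_ncard_nbrSet_add (a := a) hb {u, v, w}
    have hu : u ∉ ({v, w} : Finset (Fin 6)) := by simp [huv, hwu.symm]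
    simp only [Finset.sum_insert hu, Finset.sum_pair hwv.symm, ha, codegree_comm a b v u,
      codegree_comm a b w u, codegree_comm a b w v, Finset.coe_insert, Finset.coe_singleton] at h'
    omega
  exact exists_of_codegree_relations (P := fun x z => (nbrSet a b {x, z}).ncard)
    (T := fun w => (nbrSet a b {u, v, w}).ncard) (codegree_comm a b) hp hq hr huv hnotcomp
    hrow hdiag hpair htriple
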